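/- Let N ≥ 2 and let Sα = (1/2) Σ_{n=1}^{N} σα^(n) (α = x,y,z) be the collective spin operators of an N-qubit system, and for nonnegative reals γx, γy, γz define the collective-decoherence generator 𝒟(X) = −Σ_{α∈{x,y,z}} γα (Sα²X + XSα² − 2SαXSα). Then for every 1 ≤ n ≤ N−1, 𝒟(σz^(n)σz^(n+1)) = −2[ (γx+γy) σz^(n)σz^(n+1) − γy σx^(n)σx^(n+1) − γx σy^(n)σy^(n+1) ]. -/

import Mathlib

/- N-qubit operators: matrices indexed by `Fin N → Fin 2`, identified with
Kronecker products. Sites are labeled `1, …, N`. -/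

noncomputable def pauli : Fin 3 → Matrix (Fin 2) (Fin 2) ℂ :=
  ![!![0, 1; 1, 0], !![0, -Complex.I; Complex.I, 0], !![1, 0; 0, -1]]

/-- The Pauli matrix `σ_a` acting on qubit `n` (sites labeled `1, …, N`) and as the
identity elsewhere. -/
noncomputable def pauliAt (N n : ℕ) (a : Fin 3) :
    Matrix (Fin N → Fin 2) (Fin N → Fin 2) ℂ :=
  Matrix.of fun f g =>
    ∏ m : Fin N, if (m : ℕ) + 1 = n then pauli a (f m) (g m)
      else (if f m = g m then 1 else 0)


/-- Collective spin operator `S_a = (1/2) Σ_{n=1}^N σ_a^(n)`. -/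
noncomputable def collSpin (N : ℕ) (a : Fin 3) :
    Matrix (Fin N → Fin 2) (Fin N → Fin 2) ℂ :=
  ((1 : ℂ) / 2) • ∑ n ∈ Finset.Icc 1 N, pauliAt N n a

/-- Collective-decoherence generator
`𝒟(X) = −Σ_α γ_α (S_α²X + XS_α² − 2S_αXS_α)` with rates `γ : Fin 3 → ℝ`. -/
noncomputable def collDeco (N : ℕ) (γ : Fin 3 → ℝ)
    (X : Matrix (Fin N → Fin 2) (Fin N → Fin 2) ℂ) :
    Matrix (Fin N → Fin 2) (Fin N → Fin 2) ℂ :=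
  -∑ a : Fin 3, γ a •
    (collSpin N a ^ 2 * X + X * collSpin N a ^ 2
      - (2 : ℂ) • (collSpin N a * X * collSpin N a))

theorem pauliAt_mul_pauliAt_apply (N m n : ℕ) (a b : Fin 3) (f g : Fin N → Fin 2) :
    (pauliAt N m a * pauliAt N n b) f g
      = ∏ k : Fin N, ((if (k : ℕ) + 1 = m then pauli a else 1)
          * (if (k : ℕ) + 1 = n then pauli b else 1) : Matrix (Fin 2) (Fin 2) ℂ) (f k) (g k) := by
  simp only [Matrix.mul_apply, Fintype.prod_sum, pauliAt, Matrix.of_apply,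
    ← Finset.prod_mul_distrib]
  refine Finset.sum_congr rfl fun h _ => Finset.prod_congr rfl fun k _ => ?_
  congr 1 <;> split_ifs <;> simp_all [Matrix.one_apply]

theorem pauliAt_commute (N : ℕ) {m n : ℕ} (hmn : m ≠ n) (a b : Fin 3) :
    Commute (pauliAt N m a) (pauliAt N n b) := by
  ext f g
  rw [pauliAt_mul_pauliAt_apply, pauliAt_mul_pauliAt_apply]
  refine Finset.prod_congr rfl fun k _ => ?_
  split_ifs with h₁ h₂
  · exact absurd (h₁.symm.trans h₂) hmn
  all_goals simp

/-- A product rule for Pauli matrices carries over to the operators at a site of the chain. -/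
theorem pauliAt_mul_pauliAt_self {N n : ℕ} (hn : n ∈ Finset.Icc 1 N) {a b d : Fin 3} {c : ℂ}
    (h : pauli a * pauli b = c • pauli d) :
    pauliAt N n a * pauliAt N n b = c • pauliAt N n d := by
  obtain ⟨h1, h2⟩ := Finset.mem_Icc.mp hn
  have hk : n - 1 < N := by omega
  ext f g
  rw [pauliAt_mul_pauliAt_apply, Matrix.smul_apply, pauliAt, Matrix.of_apply,
    ← Finset.mul_prod_erase _ _ (Finset.mem_univ (⟨n - 1, hk⟩ : Fin N)),
    ← Finset.mul_prod_erase _ _ (Finset.mem_univ (⟨n - 1, hk⟩ : Fin N)), smul_eq_mul, ← mul_assoc]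
  congr 1
  · simp [Nat.sub_add_cancel h1, h]
  · refine Finset.prod_congr rfl fun k hk' => ?_
    have : (k : ℕ) + 1 ≠ n := fun e =>
      (Finset.mem_erase.mp hk').1 (Fin.ext (by simp; omega))
    simp [this, Matrix.one_apply]

theorem collSpin_commutator {N n : ℕ} (hn : n ∈ Finset.Icc 1 N) {a b d : Fin 3} {c c' : ℂ}
    (h : pauli a * pauli b = c • pauli d) (h' : pauli b * pauli a = c' • pauli d) :
    collSpin N a * pauliAt N n b - pauliAt N n b * collSpin N a
      = ((c - c') / 2) • pauliAt N n d := by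
  rw [collSpin, smul_mul_assoc, mul_smul_comm, ← smul_sub, Finset.sum_mul, Finset.mul_sum,
    ← Finset.sum_sub_distrib, Finset.sum_eq_single_of_mem n hn
      fun m _ hm => sub_eq_zero.mpr (pauliAt_commute N hm a b),
    pauliAt_mul_pauliAt_self hn h, pauliAt_mul_pauliAt_self hn h', ← sub_smul, smul_smul]
  congr 1
  ring

/-- The double commutator of `S` with `A * B`, when `ad S` acts on the pairs `(A, A')` and
`(B, B')` as a rotation generator. -/
theorem double_commutator_mul {R : Type*} [Ring R] [Algebra ℂ R] {S A A' B B' : R} {c : ℂ}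
    (hc : c * c = -1)
    (hA : S * A - A * S = (-c) • A') (hA' : S * A' - A' * S = c • A)
    (hB : S * B - B * S = (-c) • B') (hB' : S * B' - B' * S = c • B) :
    S ^ 2 * (A * B) + A * B * S ^ 2 - (2 : ℂ) • (S * (A * B) * S)
      = (2 : ℂ) • (A * B - A' * B') := by
  have leibniz (X Y : R) :
      S * (X * Y) - X * Y * S = (S * X - X * S) * Y + X * (S * Y - Y * S) := by noncomm_ring
  have h₁ : S * (A * B) - A * B * S = (-c) • (A' * B + A * B') := by
    rw [leibniz, hA, hB, smul_mul_assoc, mul_smul_comm, smul_add]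
  have h₂ : S * (A' * B + A * B') - (A' * B + A * B') * S = (2 * c) • (A * B - A' * B') := by
    have : S * (A' * B + A * B') - (A' * B + A * B') * S
        = (S * (A' * B) - A' * B * S) + (S * (A * B') - A * B' * S) := by noncomm_ring
    rw [this, leibniz, leibniz, hA, hB, hA', hB']
    simp only [smul_mul_assoc, mul_smul_comm]
    module
  calc S ^ 2 * (A * B) + A * B * S ^ 2 - (2 : ℂ) • (S * (A * B) * S)
      = S * (S * (A * B) - A * B * S) - (S * (A * B) - A * B * S) * S := by
        rw [two_smul]; noncomm_ring
    _ = (-c) • (S * (A' * B + A * B') - (A' * B + A * B') * S) := by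
        rw [h₁, smul_mul_assoc, mul_smul_comm, smul_sub]
    _ = (2 : ℂ) • (A * B - A' * B') := by
        rw [h₂, smul_smul]
        congr 1
        linear_combination -2 * hc

theorem pauli_x_mul_z : pauli 0 * pauli 2 = (-Complex.I) • pauli 1 := by
  ext i j; fin_cases i <;> fin_cases j <;> simp [pauli]

theorem pauli_z_mul_x : pauli 2 * pauli 0 = Complex.I • pauli 1 := by
  ext i j; fin_cases i <;> fin_cases j <;> simp [pauli]

theorem pauli_x_mul_y : pauli 0 * pauli 1 = Complex.I • pauli 2 := by
  ext i j; fin_cases i <;> fin_cases j <;> simp [pauli]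

theorem pauli_y_mul_x : pauli 1 * pauli 0 = (-Complex.I) • pauli 2 := by
  ext i j; fin_cases i <;> fin_cases j <;> simp [pauli]

theorem pauli_y_mul_z : pauli 1 * pauli 2 = Complex.I • pauli 0 := by
  ext i j; fin_cases i <;> fin_cases j <;> simp [pauli]

theorem pauli_z_mul_y : pauli 2 * pauli 1 = (-Complex.I) • pauli 0 := by
  ext i j; fin_cases i <;> fin_cases j <;> simp [pauli]

theorem collSpin_z_commute (N n : ℕ) : Commute (collSpin N 2) (pauliAt N n 2) := by
  refine Commute.smul_left (Commute.sum_left _ _ _ fun m _ => ?_) _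
  obtain rfl | h := eq_or_ne m n
  · exact Commute.refl _
  · exact pauliAt_commute N h 2 2

/-- Under collective decoherence with rates `γx, γy, γz ≥ 0`, for `1 ≤ n ≤ N − 1`,
`𝒟(σz^(n)σz^(n+1)) = −2[(γx+γy) σz^(n)σz^(n+1) − γy σx^(n)σx^(n+1) − γx σy^(n)σy^(n+1)]`. -/
theorem collDeco_zz (N : ℕ) (hN : 2 ≤ N) (γ : Fin 3 → ℝ) (hγ : ∀ a, 0 ≤ γ a)
    (n : ℕ) (hn1 : 1 ≤ n) (hnN : n ≤ N - 1) :
    collDeco N γ (pauliAt N n 2 * pauliAt N (n + 1) 2)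
      = (-2 : ℝ) •
        ((γ 0 + γ 1) • (pauliAt N n 2 * pauliAt N (n + 1) 2)
          - γ 1 • (pauliAt N n 0 * pauliAt N (n + 1) 0)
          - γ 0 • (pauliAt N n 1 * pauliAt N (n + 1) 1)) := by
  have comm_x_z {m : ℕ} (hm : m ∈ Finset.Icc 1 N) :
      collSpin N 0 * pauliAt N m 2 - pauliAt N m 2 * collSpin N 0
        = (-Complex.I) • pauliAt N m 1 := by
    rw [collSpin_commutator hm pauli_x_mul_z pauli_z_mul_x]; congr 1; ring
  have comm_x_y {m : ℕ} (hm : m ∈ Finset.Icc 1 N) :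
      collSpin N 0 * pauliAt N m 1 - pauliAt N m 1 * collSpin N 0
        = Complex.I • pauliAt N m 2 := by
    rw [collSpin_commutator hm pauli_x_mul_y pauli_y_mul_x]; congr 1; ring
  have comm_y_z {m : ℕ} (hm : m ∈ Finset.Icc 1 N) :
      collSpin N 1 * pauliAt N m 2 - pauliAt N m 2 * collSpin N 1
        = (-(-Complex.I)) • pauliAt N m 0 := by
    rw [collSpin_commutator hm pauli_y_mul_z pauli_z_mul_y]; congr 1; ring
  have comm_y_x {m : ℕ} (hm : m ∈ Finset.Icc 1 N) :
      collSpin N 1 * pauliAt N m 0 - pauliAt N m 0 * collSpin N 1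
        = (-Complex.I) • pauliAt N m 2 := by
    rw [collSpin_commutator hm pauli_y_mul_x pauli_x_mul_y]; congr 1; ring
  have hn : n ∈ Finset.Icc 1 N := Finset.mem_Icc.mpr (by omega)
  have hn' : n + 1 ∈ Finset.Icc 1 N := Finset.mem_Icc.mpr (by omega)
  have hz : collSpin N 2 ^ 2 * (pauliAt N n 2 * pauliAt N (n + 1) 2)
      + pauliAt N n 2 * pauliAt N (n + 1) 2 * collSpin N 2 ^ 2
      - (2 : ℂ) • (collSpin N 2 * (pauliAt N n 2 * pauliAt N (n + 1) 2) * collSpin N 2) = 0 := by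
    have h := (collSpin_z_commute N n).mul_right (collSpin_z_commute N (n + 1))
    rw [(h.pow_left 2).eq, h.eq, mul_assoc _ (collSpin N 2), ← pow_two, two_smul, sub_self]
  rw [collDeco, Fin.sum_univ_three, hz,
    double_commutator_mul Complex.I_mul_I (comm_x_z hn) (comm_x_y hn) (comm_x_z hn') (comm_x_y hn'),
    double_commutator_mul (by simp) (comm_y_z hn) (comm_y_x hn) (comm_y_z hn') (comm_y_x hn')]
  simp only [two_smul]
  module
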